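/- arXiv:1806.10731 — 9 statements merged into one kernel-verified Lean document; each statement's English description precedes it below -/
import Mathlib

section
/- For every path graph P_n on n ≥ 3 vertices, the maximum number of colours in a J-colouring of P_n equals 2; that is, J(P_n) = 2. -/
open SimpleGraph

/-- `c` is a proper colouring of `G` with colours `Fin k` such that the closed
neighbourhood of every vertex contains all `k` colours (a J-colouring). -/
def IsJColoring {V : Type*} (G : SimpleGraph V) (k : ℕ) (c : V → Fin k) : Prop :=
  (∀ ⦃u v : V⦄, G.Adj u v → c u ≠ c v) ∧
  ∀ v : V, ∀ i : Fin k, ∃ u : V, (u = v ∨ G.Adj v u) ∧ c u = i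

/-- `G` has a J-colouring with `k` colours. -/
def HasJColoring {V : Type*} (G : SimpleGraph V) (k : ℕ) : Prop :=
  ∃ c : V → Fin k, IsJColoring G k c

/-- `G` admits a J-colouring (with some number `k ≥ 1` of colours). -/
def AdmitsJColoring {V : Type*} (G : SimpleGraph V) : Prop :=
  ∃ k : ℕ, 1 ≤ k ∧ HasJColoring G k

/-- `c` is a proper colouring of `G` with colours `Fin k` such that the closed
neighbourhood of every internal vertex (vertex of degree at least 2) contains
all `k` colours (a J*-colouring). -/
def IsJStarColoring {V : Type*} (G : SimpleGraph V) (k : ℕ) (c : V → Fin k) : Prop :=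
  (∀ ⦃u v : V⦄, G.Adj u v → c u ≠ c v) ∧
  ∀ v : V, (∃ a b : V, a ≠ b ∧ G.Adj v a ∧ G.Adj v b) →
    ∀ i : Fin k, ∃ u : V, (u = v ∨ G.Adj v u) ∧ c u = i

/-- `G` has a J*-colouring with `k` colours. -/
def HasJStarColoring {V : Type*} (G : SimpleGraph V) (k : ℕ) : Prop :=
  ∃ c : V → Fin k, IsJStarColoring G k c

/-- The wheel graph `W_{n+1} = K_1 + C_n`: the cycle graph on `Fin n` together
with a central vertex `none` adjacent to every cycle vertex. -/
def wheelGraph (n : ℕ) : SimpleGraph (Option (Fin n)) :=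
  SimpleGraph.fromRel (fun u v =>
    (∃ i : Fin n, u = none ∧ v = some i) ∨
    (∃ i j : Fin n, u = some i ∧ v = some j ∧ (SimpleGraph.cycleGraph n).Adj i j))

/-- The Jahangir graph `J_{n,m}`: the cycle graph on `Fin (n*m)` together with a
central vertex `none` adjacent exactly to the `m` cycle vertices whose index is
a multiple of `n`. -/
def jahangirGraph (n m : ℕ) : SimpleGraph (Option (Fin (n * m))) :=
  SimpleGraph.fromRel (fun u v =>
    (∃ i : Fin (n * m), u = none ∧ v = some i ∧ n ∣ (i : ℕ)) ∨
    (∃ i j : Fin (n * m), u = some i ∧ v = some j ∧ (SimpleGraph.cycleGraph (n * m)).Adj i j))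


/-- Every colour of a J-colouring of a path occurs on one of its first two vertices. -/
theorem IsJColoring.eq_or_eq_pathGraph {n k : ℕ} (hn : 1 < n) {c : Fin n → Fin k}
    (hc : IsJColoring (pathGraph n) k c) (i : Fin k) :
    i = c ⟨0, by lia⟩ ∨ i = c ⟨1, hn⟩ := by
  obtain ⟨u, rfl | hu, rfl⟩ := hc.2 ⟨0, by lia⟩ i
  · exact Or.inl rfl
  · refine Or.inr (congrArg c (Fin.ext ?_))
    simp only [pathGraph_adj] at hu
    lia

theorem IsJColoring.le_two_of_pathGraph {n k : ℕ} (hn : 1 < n) {c : Fin n → Fin k}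
    (hc : IsJColoring (pathGraph n) k c) : k ≤ 2 := by
  have hsub : (Finset.univ : Finset (Fin k)) ⊆ {c ⟨0, by lia⟩, c ⟨1, hn⟩} := fun i _ => by
    simpa using hc.eq_or_eq_pathGraph hn i
  simpa using (Finset.card_le_card hsub).trans Finset.card_le_two

/-- Colouring the vertices of a path by parity is a J-colouring. -/
theorem isJColoring_pathGraph_two {n : ℕ} (hn : 1 < n) :
    IsJColoring (pathGraph n) 2 (fun v => ⟨v % 2, Nat.mod_lt _ two_pos⟩) := by
  refine ⟨fun u v h => ?_, fun v i => ?_⟩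
  · rw [pathGraph_adj] at h
    simp only [ne_eq, Fin.mk.injEq]
    lia
  · simp only [pathGraph_adj, Fin.ext_iff]
    by_cases hi : (v : ℕ) % 2 = i
    · exact ⟨v, Or.inl rfl, hi⟩
    · by_cases hv : (v : ℕ) + 1 < n
      · exact ⟨⟨v + 1, hv⟩, Or.inr (Or.inl rfl), by lia⟩
      · exact ⟨⟨v - 1, by lia⟩, Or.inr (Or.inr (by lia)), by lia⟩

theorem stmt0 (n : ℕ) (hn : 3 ≤ n) :
    IsGreatest {k : ℕ | HasJColoring (SimpleGraph.pathGraph n) k} 2 := by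
  refine ⟨⟨_, isJColoring_pathGraph_two (by lia)⟩, ?_⟩
  rintro k ⟨c, hc⟩
  exact hc.le_two_of_pathGraph (by lia)
end

section
/- For every path graph P_n on n ≥ 3 vertices, the maximum number of colours in a J*-colouring of P_n equals 3; that is, J*(P_n) = 3. -/
open SimpleGraph

/-- A J*-colouring of a path on at least three vertices uses at most three colours. -/
theorem HasJStarColoring.le_three_of_pathGraph {n k : ℕ} (hn : 3 ≤ n)
    (h : HasJStarColoring (SimpleGraph.pathGraph n) k) : k ≤ 3 := by
  obtain ⟨c, -, hc⟩ := h
  have hint := hc ⟨1, by omega⟩ ⟨⟨0, by omega⟩, ⟨2, by omega⟩, by simp,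
    by simp [pathGraph_adj], by simp [pathGraph_adj]⟩
  have hsub : (Finset.univ : Finset (Fin k)) ⊆
      {c ⟨0, by omega⟩, c ⟨1, by omega⟩, c ⟨2, by omega⟩} := by
    intro i _
    obtain ⟨⟨u, hu⟩, hadj, rfl⟩ := hint i
    simp only [pathGraph_adj, Fin.mk.injEq] at hadj
    have hcases : u = 0 ∨ u = 1 ∨ u = 2 := by omega
    rcases hcases with rfl | rfl | rfl <;> simp
  simpa using (Finset.card_le_card hsub).trans Finset.card_le_three

/-- Colouring vertices by their index modulo `3` is a J*-colouring of a path. -/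
theorem hasJStarColoring_pathGraph_three (n : ℕ) :
    HasJStarColoring (SimpleGraph.pathGraph n) 3 := by
  refine ⟨fun v => ⟨v.val % 3, by omega⟩, fun u v huv => ?_, ?_⟩
  · rw [pathGraph_adj] at huv
    simp only [ne_eq, Fin.mk.injEq]
    omega
  · rintro ⟨v, hv⟩ ⟨⟨a, ha⟩, ⟨b, hb⟩, hab, hva, hvb⟩ ⟨i, hi⟩
    simp only [pathGraph_adj, ne_eq, Fin.mk.injEq] at hab hva hvb
    simp only [pathGraph_adj, Fin.mk.injEq]
    have hcases : v % 3 = i ∨ a % 3 = i ∨ b % 3 = i := by omega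
    rcases hcases with h | h | h
    · exact ⟨⟨v, hv⟩, Or.inl rfl, h⟩
    · exact ⟨⟨a, ha⟩, Or.inr hva, h⟩
    · exact ⟨⟨b, hb⟩, Or.inr hvb, h⟩

theorem stmt1 (n : ℕ) (hn : 3 ≤ n) :
    IsGreatest {k : ℕ | HasJStarColoring (SimpleGraph.pathGraph n) k} 3 := by
  exact ⟨hasJStarColoring_pathGraph_three n, fun _ hk => hk.le_three_of_pathGraph hn⟩
end

section
/- For n ≥ 3, the cycle graph C_n admits a J-colouring if and only if n ≡ 0 (mod 2) or n ≡ 0 (mod 3). -/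
open SimpleGraph

theorem cycleGraph_adj_iff_val {n : ℕ} (hn : 2 ≤ n) (u v : Fin n) :
    (cycleGraph n).Adj u v ↔
      (v.val = u.val + 1 ∨ u.val + 1 = n ∧ v.val = 0) ∨
      (u.val = v.val + 1 ∨ v.val + 1 = n ∧ u.val = 0) := by
  have sub_val_eq_one (a b : Fin n) :
      (a - b).val = 1 ↔ a.val = b.val + 1 ∨ b.val + 1 = n ∧ a.val = 0 := by
    have ha := a.isLt
    have hb := b.isLt
    rw [Fin.val_sub]
    rcases lt_or_ge (n - b.val + a.val) n with h | h
    · rw [Nat.mod_eq_of_lt h]; omega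
    · rw [Nat.mod_eq_sub_mod h, Nat.mod_eq_of_lt (by omega)]; omega
  rw [cycleGraph_adj', sub_val_eq_one, sub_val_eq_one, or_comm]

theorem hasJColoring_cycleGraph_of_dvd {n p : ℕ} (hn : 3 ≤ n) (hp : p = 2 ∨ p = 3)
    (h : n % p = 0) : HasJColoring (cycleGraph n) p := by
  refine ⟨fun v => ⟨v.val % p, Nat.mod_lt _ (by omega)⟩, ?_, ?_⟩
  · intro u v huv
    rw [cycleGraph_adj_iff_val (by omega)] at huv
    rw [Ne, Fin.mk.injEq]
    rcases hp with rfl | rfl <;> omega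
  · intro v i
    have hv := v.isLt
    have hi := i.isLt
    obtain ⟨s, hs⟩ : ∃ s : Fin n, s.val = v.val + 1 ∨ v.val + 1 = n ∧ s.val = 0 := by
      by_cases hlast : v.val + 1 = n
      · exact ⟨⟨0, by omega⟩, Or.inr ⟨hlast, rfl⟩⟩
      · exact ⟨⟨v.val + 1, by omega⟩, Or.inl rfl⟩
    obtain ⟨t, ht⟩ : ∃ t : Fin n, v.val = t.val + 1 ∨ t.val + 1 = n ∧ v.val = 0 := by
      by_cases hzero : v.val = 0
      · exact ⟨⟨n - 1, by omega⟩, Or.inr ⟨by dsimp only; omega, hzero⟩⟩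
      · exact ⟨⟨v.val - 1, by omega⟩, Or.inl (by dsimp only; omega)⟩
    have hcover : v.val % p = i.val ∨ s.val % p = i.val ∨ t.val % p = i.val := by
      rcases hp with rfl | rfl <;> omega
    rcases hcover with h | h | h
    · exact ⟨v, Or.inl rfl, Fin.ext h⟩
    · exact ⟨s, Or.inr ((cycleGraph_adj_iff_val (by omega) _ _).2 (Or.inl hs)), Fin.ext h⟩
    · exact ⟨t, Or.inr ((cycleGraph_adj_iff_val (by omega) _ _).2 (Or.inr ht)), Fin.ext h⟩

/-- Reading a J-colouring along the cycle gives a sequence that closes up after `n` steps and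
whose consecutive terms differ and consecutive triples meet every colour. -/
theorem IsJColoring.exists_closed_sequence {n k : ℕ} (hn : 3 ≤ n) {c : Fin n → Fin k}
    (hc : IsJColoring (cycleGraph n) k c) :
    ∃ f : ℕ → Fin k, f n = f 0 ∧ (∀ i, f i ≠ f (i + 1)) ∧
      ∀ i x, x = f i ∨ x = f (i + 1) ∨ x = f (i + 2) := by
  have hpos : 0 < n := by omega
  have succ_mod (i : ℕ) :
      (i + 1) % n = i % n + 1 ∨ i % n + 1 = n ∧ (i + 1) % n = 0 := by
    have hi := Nat.mod_lt i hpos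
    rw [← Nat.mod_add_mod i n 1]
    rcases Nat.lt_or_ge (i % n + 1) n with h | h
    · exact Or.inl (Nat.mod_eq_of_lt h)
    · have h' : i % n + 1 = n := by omega
      exact Or.inr ⟨h', by rw [h', Nat.mod_self]⟩
  refine ⟨fun i => c ⟨i % n, Nat.mod_lt _ hpos⟩, by simp, fun i => ?_, fun i x => ?_⟩
  · exact hc.1 ((cycleGraph_adj_iff_val (by omega) _ _).2 (Or.inl (succ_mod i)))
  · obtain ⟨u, hu, rfl⟩ := hc.2 ⟨(i + 1) % n, Nat.mod_lt _ hpos⟩ x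
    rw [cycleGraph_adj_iff_val (by omega)] at hu
    have h₁ := succ_mod i
    have h₂ := succ_mod (i + 1)
    have hi := Nat.mod_lt i hpos
    have hi₁ := Nat.mod_lt (i + 1) hpos
    have hi₂ := Nat.mod_lt (i + 2) hpos
    have hu_lt := u.isLt
    have hcases : u.val = i % n ∨ u.val = (i + 1) % n ∨ u.val = (i + 2) % n := by
      rcases hu with rfl | hu
      · exact Or.inr (Or.inl rfl)
      · dsimp only at hu
        rw [show i + 1 + 1 = i + 2 from rfl] at h₂
        omega
    exact hcases.imp (fun h => congrArg c (Fin.ext h))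
      (Or.imp (fun h => congrArg c (Fin.ext h)) fun h => congrArg c (Fin.ext h))

theorem mod_two_or_three_of_hasJColoring_cycleGraph {n k : ℕ} (hn : 3 ≤ n)
    (h : HasJColoring (cycleGraph n) k) : n % 2 = 0 ∨ n % 3 = 0 := by
  obtain ⟨c, hc⟩ := h
  obtain ⟨f, hfn, hne, hcover⟩ := hc.exists_closed_sequence hn
  have hk : k ≤ 3 := by
    have hsub : (Finset.univ : Finset (Fin k)) ⊆ {f 0, f 1, f 2} := fun x _ => by
      simpa using hcover 0 x
    simpa using (Finset.card_le_card hsub).trans Finset.card_le_three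
  have h01 := hne 0
  have h12 := hne 1
  interval_cases k
  · exact (f 0).elim0
  · exact absurd (Subsingleton.elim _ _) h01
  · left
    have hper : Function.Periodic f 2 := fun i => by
      have ha := hne i
      have hb := hne (i + 1)
      rw [show i + 1 + 1 = i + 2 from rfl] at hb
      omega
    rw [← hper.map_mod_nat n] at hfn
    rcases Nat.mod_two_eq_zero_or_one n with h | h
    · exact h
    · rw [h] at hfn
      exact absurd hfn.symm h01
  · right
    have distinct (i : ℕ) : f i ≠ f (i + 2) := fun h => by
      have h0 := hcover i 0
      have h1 := hcover i 1
      have h2 := hcover i 2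
      omega
    have hper : Function.Periodic f 3 := fun i => by
      have ha := hne i
      have hb := hne (i + 1)
      have hd := hne (i + 2)
      have he := distinct i
      have hg := distinct (i + 1)
      rw [show i + 1 + 1 = i + 2 from rfl] at hb
      rw [show i + 2 + 1 = i + 3 from rfl] at hd
      rw [show i + 1 + 2 = i + 3 from rfl] at hg
      omega
    rw [← hper.map_mod_nat n] at hfn
    have hlt := Nat.mod_lt n (show 0 < 3 by decide)
    interval_cases hmod : n % 3
    · rfl
    · exact absurd hfn.symm h01
    · exact absurd hfn.symm (distinct 0)

theorem stmt3 (n : ℕ) (hn : 3 ≤ n) :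
    AdmitsJColoring (SimpleGraph.cycleGraph n) ↔ (n % 2 = 0 ∨ n % 3 = 0) := by
  constructor
  · rintro ⟨k, -, h⟩
    exact mod_two_or_three_of_hasJColoring_cycleGraph hn h
  · rintro (h | h)
    · exact ⟨2, by decide, hasJColoring_cycleGraph_of_dvd hn (Or.inl rfl) h⟩
    · exact ⟨3, by decide, hasJColoring_cycleGraph_of_dvd hn (Or.inr rfl) h⟩
end

section
/- For n ≥ 3 with n ≡ 0 (mod 3), the maximum number of colours in a J-colouring of the cycle graph C_n equals 3; that is, J(C_n) = 3. -/
open SimpleGraph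

theorem HasJColoring.le_degree_add_one {V : Type*} {G : SimpleGraph V} {k : ℕ}
    (h : HasJColoring G k) (v : V) [Fintype (G.neighborSet v)] : k ≤ G.degree v + 1 := by
  classical
  obtain ⟨c, -, hc⟩ := h
  have hsub : (Finset.univ : Finset (Fin k)) ⊆ (insert v (G.neighborFinset v)).image c := by
    intro i _
    obtain ⟨u, hu, rfl⟩ := hc v i
    exact Finset.mem_image_of_mem c (by simpa using hu)
  calc k = (Finset.univ : Finset (Fin k)).card := by simp
    _ ≤ ((insert v (G.neighborFinset v)).image c).card := Finset.card_le_card hsub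
    _ ≤ (insert v (G.neighborFinset v)).card := Finset.card_image_le
    _ ≤ G.degree v + 1 := Finset.card_insert_le _ _

theorem cycleGraph_adj_iff_mod {n : ℕ} (hn : 2 ≤ n) (u v : Fin n) :
    (cycleGraph n).Adj u v ↔ (u : ℕ) = (v + 1) % n ∨ (v : ℕ) = (u + 1) % n := by
  obtain ⟨m, rfl⟩ := Nat.exists_eq_add_of_le' hn
  rw [cycleGraph_adj, sub_eq_iff_eq_add, sub_eq_iff_eq_add, Fin.ext_iff, Fin.ext_iff,
    Fin.val_add, Fin.val_add, Fin.val_one, add_comm 1, add_comm 1]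

theorem hasJColoring_cycleGraph_three {n : ℕ} (hn : 3 ≤ n) (h3 : n % 3 = 0) :
    HasJColoring (cycleGraph n) 3 := by
  have hdvd : 3 ∣ n := Nat.dvd_of_mod_eq_zero h3
  refine ⟨fun i => ⟨i % 3, Nat.mod_lt _ (by norm_num)⟩, fun u v huv => ?_, fun v i => ?_⟩
  · rw [cycleGraph_adj_iff_mod (by lia)] at huv
    have hu := Nat.mod_mod_of_dvd (u + 1 : ℕ) hdvd
    have hv := Nat.mod_mod_of_dvd (v + 1 : ℕ) hdvd
    simp only [ne_eq, Fin.mk.injEq]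
    lia
  · have hpos : 0 < n := by lia
    have hsucc := Nat.mod_mod_of_dvd (v + 1 : ℕ) hdvd
    have hpred := Nat.mod_mod_of_dvd (v + (n - 1) : ℕ) hdvd
    have hback : (v : ℕ) = ((v + (n - 1)) % n + 1) % n := by
      rw [Nat.mod_add_mod, add_assoc, Nat.sub_add_cancel hpos, Nat.add_mod_right,
        Nat.mod_eq_of_lt v.isLt]
    have hi := i.isLt
    have hcases : (v : ℕ) % 3 = i ∨ (v + 1 : ℕ) % 3 = i ∨ (v + (n - 1) : ℕ) % 3 = i := by
      clear hsucc hpred hback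
      omega
    rcases hcases with h | h | h
    · exact ⟨v, Or.inl rfl, Fin.ext h⟩
    · exact ⟨⟨(v + 1) % n, Nat.mod_lt _ hpos⟩,
        Or.inr ((cycleGraph_adj_iff_mod (by lia) _ _).2 (Or.inr rfl)), Fin.ext (hsucc.trans h)⟩
    · exact ⟨⟨(v + (n - 1)) % n, Nat.mod_lt _ hpos⟩,
        Or.inr ((cycleGraph_adj_iff_mod (by lia) _ _).2 (Or.inl hback)), Fin.ext (hpred.trans h)⟩

theorem stmt4 (n : ℕ) (hn : 3 ≤ n) (h3 : n % 3 = 0) :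
    IsGreatest {k : ℕ | HasJColoring (SimpleGraph.cycleGraph n) k} 3 := by
  refine ⟨hasJColoring_cycleGraph_three hn h3, fun k hk => ?_⟩
  obtain ⟨m, rfl⟩ := Nat.exists_eq_add_of_le' hn
  simpa only [cycleGraph_degree_three_le] using hk.le_degree_add_one 0
end

section
/- For n ≥ 3 with n ≡ 0 (mod 2) and n ≢ 0 (mod 3), the maximum number of colours in a J-colouring of the cycle graph C_n equals 2; that is, J(C_n) = 2. -/
open SimpleGraph

theorem hasJColoring_two_cycleGraph_of_even {n : ℕ} (hn : 2 ≤ n) (h : Even n) :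
    HasJColoring (cycleGraph n) 2 := by
  obtain ⟨m, rfl⟩ := Nat.exists_eq_add_of_le' hn
  let C := cycleGraph.bicoloring_of_even (m + 2) h
  refine ⟨fun v => finTwoEquiv.symm (C v), fun u v huv => ?_, fun v i => ?_⟩
  · simpa using C.valid huv
  · have hadj : (cycleGraph (m + 2)).Adj v (v + 1) := by simp [cycleGraph_adj]
    have hne := C.valid hadj
    by_cases hv : C v = finTwoEquiv i
    · exact ⟨v, Or.inl rfl, by simp [hv]⟩
    · refine ⟨v + 1, Or.inr hadj, ?_⟩
      rw [Equiv.symm_apply_eq]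
      exact (Bool.eq_not.mpr hne.symm).trans (Bool.eq_not.mpr (Ne.symm hv)).symm

/-- In a J-colouring of a cycle, any three consecutive vertices carry all colours. -/
theorem IsJColoring.exists_consecutive {m k : ℕ} {c : Fin (m + 2) → Fin k}
    (hc : IsJColoring (cycleGraph (m + 2)) k c) (x : Fin (m + 2)) (i : Fin k) :
    c x = i ∨ c (x + 1) = i ∨ c (x + 1 + 1) = i := by
  obtain ⟨u, hu, rfl⟩ := hc.2 (x + 1) i
  rcases hu with rfl | hu
  · simp
  · have hu' : u ∈ (cycleGraph (m + 2)).neighborSet (x + 1) := hu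
    rw [cycleGraph_neighborSet] at hu'
    rcases hu' with rfl | rfl <;> simp

theorem IsJColoring.cycleGraph_le_three {m k : ℕ} {c : Fin (m + 2) → Fin k}
    (hc : IsJColoring (cycleGraph (m + 2)) k c) : k ≤ 3 := by
  have hsurj : Function.Surjective ![c 0, c (0 + 1), c (0 + 1 + 1)] := fun i => by
    rcases hc.exists_consecutive 0 i with h | h | h
    exacts [⟨0, h⟩, ⟨1, h⟩, ⟨2, h⟩]
  simpa using Fintype.card_le_of_surjective _ hsurj

theorem three_dvd_of_hasJColoring_three_cycleGraph {n : ℕ} (hn : 2 ≤ n)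
    (h : HasJColoring (cycleGraph n) 3) : 3 ∣ n := by
  obtain ⟨m, rfl⟩ := Nat.exists_eq_add_of_le' hn
  obtain ⟨c, hc⟩ := h
  let f : ℕ → Fin 3 := fun i => c (i • 1)
  have window (x : ℕ) (i : Fin 3) : f x = i ∨ f (x + 1) = i ∨ f (x + 2) = i := by
    simpa only [f, succ_nsmul] using hc.exists_consecutive (x • 1) i
  have distinct (x : ℕ) : f x ≠ f (x + 1) ∧ f x ≠ f (x + 2) ∧ f (x + 1) ≠ f (x + 2) := by
    have h0 := window x 0
    have h1 := window x 1
    have h2 := window x 2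
    simp only [Fin.ext_iff, ne_eq] at *
    norm_num at *
    omega
  have step : Function.Periodic f 3 := fun x => by
    have h0 := distinct x
    have h1 := distinct (x + 1)
    simp only [Fin.ext_iff, ne_eq, add_assoc] at *
    norm_num at *
    omega
  have wrap : f (m + 2) = f 0 := by
    have h0 : (m + 2) • (1 : Fin (m + 2)) = 0 := by
      simpa using card_nsmul_eq_zero (x := (1 : Fin (m + 2)))
    simp only [f, h0, zero_nsmul]
  have hmod := step.map_mod_nat (m + 2)
  have hlt : (m + 2) % 3 < 3 := Nat.mod_lt _ (by norm_num)
  rw [wrap] at hmod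
  obtain ⟨h01, h02, -⟩ := distinct 0
  rw [Nat.dvd_iff_mod_eq_zero]
  generalize (m + 2) % 3 = r at *
  interval_cases r
  · rfl
  · exact absurd hmod.symm h01
  · exact absurd hmod.symm h02

theorem stmt5 (n : ℕ) (hn : 3 ≤ n) (h2 : n % 2 = 0) (h3 : n % 3 ≠ 0) :
    IsGreatest {k : ℕ | HasJColoring (SimpleGraph.cycleGraph n) k} 2 := by
  refine ⟨hasJColoring_two_cycleGraph_of_even (by omega) (Nat.even_iff.mpr h2), fun k hk => ?_⟩
  have hle : k ≤ 3 := by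
    obtain ⟨m, rfl⟩ := Nat.exists_eq_add_of_le' (show 2 ≤ n by omega)
    obtain ⟨c, hc⟩ := hk
    exact hc.cycleGraph_le_three
  by_contra hlt
  obtain rfl : k = 3 := by omega
  have := three_dvd_of_hasJColoring_three_cycleGraph (by omega) hk
  omega
end

section
/- For n ≥ 3 with n ≡ 0 (mod 2) and n ≢ 0 (mod 3), the wheel graph W_{n+1} = K_1 + C_n admits a J-colouring and the maximum number of colours in a J-colouring of W_{n+1} equals 3; that is, J(W_{n+1}) = 3. -/
open SimpleGraph

theorem wheelGraph_adj_none_some {n : ℕ} (i : Fin n) : (wheelGraph n).Adj none (some i) := by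
  simp [wheelGraph]

theorem wheelGraph_adj_some_some {n : ℕ} (hn : 2 ≤ n) (i j : Fin n) :
    (wheelGraph n).Adj (some i) (some j) ↔
      (i + 1 : ℕ) % n = j ∨ (j + 1 : ℕ) % n = i := by
  have hi := i.isLt
  have hj := j.isLt
  have hmod : ∀ a b : ℕ, a < n → b < n → ((n - b + a) % n = 1 ↔ (b + 1) % n = a) := by
    intro a b ha hb
    have h₁ : (b + 1) % n = if b + 1 = n then 0 else b + 1 := by
      split_ifs with h
      · simp [h]
      · exact Nat.mod_eq_of_lt (by omega)
    have h₂ : (n - b + a) % n = if b ≤ a then a - b else n - b + a := by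
      split_ifs with h
      · rw [show n - b + a = (a - b) + n by omega, Nat.add_mod_right,
          Nat.mod_eq_of_lt (by omega)]
      · exact Nat.mod_eq_of_lt (by omega)
    rw [h₁, h₂]
    split_ifs <;> omega
  have hadj : (cycleGraph n).Adj i j ↔
      (i + 1 : ℕ) % n = j ∨ (j + 1 : ℕ) % n = i := by
    rw [cycleGraph_adj', Fin.val_sub, Fin.val_sub, hmod _ _ hi hj, hmod _ _ hj hi, or_comm]
  rw [← hadj]
  constructor
  · rintro ⟨-, (⟨_, h, -⟩ | ⟨a, b, ha, hb, h⟩) | (⟨_, h, -⟩ | ⟨a, b, ha, hb, h⟩)⟩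
    · cases h
    · cases ha; cases hb; exact h
    · cases h
    · cases ha; cases hb; exact h.symm
  · intro h
    exact ⟨fun he => h.ne (Option.some.inj he), Or.inl (Or.inr ⟨i, j, rfl, rfl, h⟩)⟩

/-- An even wheel is J-coloured by giving the hub one colour and alternating the other two
along the rim. -/
theorem hasJColoring_wheelGraph_three {n : ℕ} (hn : 2 ≤ n) (h2 : n % 2 = 0) :
    HasJColoring (wheelGraph n) 3 := by
  have hpar : ∀ m : ℕ, (m + 1) % n % 2 = (m + 1) % 2 := fun m =>
    Nat.mod_mod_of_dvd _ (Nat.dvd_of_mod_eq_zero h2)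
  let c : Option (Fin n) → Fin 3 := fun v =>
    v.elim 2 fun i => if (i : ℕ) % 2 = 0 then 0 else 1
  have hc_none : c none = 2 := rfl
  have hc_some : ∀ i : Fin n, c (some i) = if (i : ℕ) % 2 = 0 then 0 else 1 := fun _ => rfl
  refine ⟨c, ?_, ?_⟩
  · rintro (_ | i) (_ | j) h
    · exact absurd h ((wheelGraph n).irrefl)
    · rw [hc_none, hc_some]
      split_ifs <;> decide
    · rw [hc_none, hc_some]
      split_ifs <;> decide
    · rw [wheelGraph_adj_some_some hn] at h
      have hi := hpar i
      have hj := hpar j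
      rw [hc_some, hc_some]
      split_ifs <;> first | decide | omega
  · rintro (_ | i) k
    · fin_cases k
      · exact ⟨some ⟨0, by omega⟩, Or.inr (wheelGraph_adj_none_some _), rfl⟩
      · exact ⟨some ⟨1, by omega⟩, Or.inr (wheelGraph_adj_none_some _), rfl⟩
      · exact ⟨none, Or.inl rfl, rfl⟩
    · have hi := hpar i
      have hadj : (wheelGraph n).Adj (some i) (some ⟨(i + 1) % n, Nat.mod_lt _ (by omega)⟩) :=
        (wheelGraph_adj_some_some hn _ _).2 (Or.inl rfl)
      rcases Nat.mod_two_eq_zero_or_one i with h | h <;> fin_cases k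
      · exact ⟨some i, Or.inl rfl, by simp [hc_some, h]⟩
      · refine ⟨_, Or.inr hadj, ?_⟩
        rw [hc_some, if_neg (by simp only; omega)]
        rfl
      · exact ⟨none, Or.inr (wheelGraph_adj_none_some i).symm, rfl⟩
      · refine ⟨_, Or.inr hadj, ?_⟩
        rw [hc_some, if_pos (by simp only; omega)]
        rfl
      · exact ⟨some i, Or.inl rfl, by simp [hc_some, h]⟩
      · exact ⟨none, Or.inr (wheelGraph_adj_none_some i).symm, rfl⟩

theorem pairwise_ne_of_forall_eq_of_four_le {k : ℕ} (hk : 4 ≤ k) {x y z w : Fin k}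
    (h : ∀ i, i = x ∨ i = y ∨ i = z ∨ i = w) :
    x ≠ y ∧ x ≠ z ∧ x ≠ w ∧ y ≠ z ∧ y ≠ w ∧ z ≠ w := by
  have key : ∀ p q r : Fin k, ¬ ∀ i, i = p ∨ i = q ∨ i = r := by
    intro p q r hpqr
    have huniv : (Finset.univ : Finset (Fin k)) ⊆ {p, q, r} := fun i _ => by
      simpa using hpqr i
    have hcard := (Finset.card_le_card huniv).trans Finset.card_le_three
    rw [Finset.card_univ, Fintype.card_fin] at hcard
    omega
  refine ⟨?_, ?_, ?_, ?_, ?_, ?_⟩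
  · rintro rfl; exact key x z w (fun i => by have := h i; tauto)
  · rintro rfl; exact key x y w (fun i => by have := h i; tauto)
  · rintro rfl; exact key x y z (fun i => by have := h i; tauto)
  · rintro rfl; exact key x y w (fun i => by have := h i; tauto)
  · rintro rfl; exact key x y z (fun i => by have := h i; tauto)
  · rintro rfl; exact key x y z (fun i => by have := h i; tauto)

/-- With at least four colours, the colours along the rim repeat with period three. -/
theorem three_dvd_of_hasJColoring_wheelGraph {n k : ℕ} (hn : 2 ≤ n) (hk : 4 ≤ k)
    (h : HasJColoring (wheelGraph n) k) : 3 ∣ n := by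
  obtain ⟨c, -, hc⟩ := h
  let f : ℕ → Fin k := fun m => c (some ⟨m % n, Nat.mod_lt _ (by omega)⟩)
  have hcover : ∀ m i, i = f m ∨ i = f (m + 1) ∨ i = f (m + 2) ∨ i = c none := by
    intro m i
    obtain ⟨u, hu, rfl⟩ := hc (some ⟨(m + 1) % n, Nat.mod_lt _ (by omega)⟩) i
    rcases u with _ | j
    · simp
    rcases hu with hu | hu
    · simp [f, hu]
    rw [wheelGraph_adj_some_some hn] at hu
    rcases hu with hu | hu
    · have : j = ⟨(m + 2) % n, Nat.mod_lt _ (by omega)⟩ := by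
        ext
        simp [← hu]
      simp [f, this]
    · have : j = ⟨m % n, Nat.mod_lt _ (by omega)⟩ := by
        ext
        have hj : (j : ℕ) ≡ m [MOD n] := Nat.ModEq.add_right_cancel' 1 hu
        rw [← Nat.mod_eq_of_lt j.isLt]
        exact hj
      simp [f, this]
  have hne := fun m => pairwise_ne_of_forall_eq_of_four_le hk (hcover m)
  have hper : ∀ m, f (m + 3) = f m := by
    intro m
    obtain ⟨-, h₁, -, h₂, -, h₃⟩ := hne (m + 1)
    have := hcover m (f (m + 3))
    grind
  have hper' : ∀ q m, f (m + 3 * q) = f m := by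
    intro q m
    induction q with
    | zero => rfl
    | succ q ih => rw [show m + 3 * (q + 1) = m + 3 * q + 3 by ring, hper, ih]
  have hfn : f n = f 0 := by simp [f]
  have hmod := hper' (n / 3) (n % 3)
  rw [Nat.mod_add_div, hfn] at hmod
  obtain ⟨h₁, h₂, -⟩ := hne 0
  have : n % 3 = 0 ∨ n % 3 = 1 ∨ n % 3 = 2 := by omega
  rcases this with h | h | h
  · exact Nat.dvd_of_mod_eq_zero h
  · rw [h] at hmod
    exact absurd hmod h₁
  · rw [h] at hmod
    exact absurd hmod h₂

theorem stmt6 (n : ℕ) (hn : 3 ≤ n) (h2 : n % 2 = 0) (h3 : n % 3 ≠ 0) :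
    AdmitsJColoring (wheelGraph n) ∧
      IsGreatest {k : ℕ | HasJColoring (wheelGraph n) k} 3 := by
  have h := hasJColoring_wheelGraph_three (by omega) h2
  refine ⟨⟨3, by norm_num, h⟩, h, fun k hk => ?_⟩
  by_contra! hlt
  exact h3 (Nat.mod_eq_zero_of_dvd (three_dvd_of_hasJColoring_wheelGraph (by omega) hlt hk))
end

section
/- Let n ≥ 1 and m ≥ 3. If m is even and n ≡ 1 (mod 3), then the Jahangir graph J_{n,m} admits a J-colouring with exactly 3 colours. -/
open SimpleGraph

/-- Adjacency in a cycle graph, in terms of the cyclic successor on natural numbers. -/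
lemma cycleGraph_adj_iff_val_s10 {N : ℕ} (hN : 2 ≤ N) (i j : Fin N) :
    (cycleGraph N).Adj i j ↔
      (j : ℕ) = ((i : ℕ) + 1) % N ∨ (i : ℕ) = ((j : ℕ) + 1) % N := by
  have hi := i.isLt
  have hj := j.isLt
  have succ_mod (a : ℕ) (ha : a < N) : (a + 1) % N = if a + 1 = N then 0 else a + 1 := by
    split_ifs with h
    · rw [h, Nat.mod_self]
    · exact Nat.mod_eq_of_lt (by omega)
  rw [cycleGraph_adj', succ_mod i hi, succ_mod j hj]
  rcases lt_trichotomy i j with h | h | h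
  · rw [Fin.coe_sub_iff_lt.2 h, Fin.sub_val_of_le h.le]
    rw [Fin.lt_def] at h
    split_ifs <;> omega
  · subst h
    rw [Fin.sub_val_of_le le_rfl]
    split_ifs <;> omega
  · rw [Fin.coe_sub_iff_lt.2 h, Fin.sub_val_of_le h.le]
    rw [Fin.lt_def] at h
    split_ifs <;> omega

/-- The distance from `i` to the nearest multiple of `2 * n`. -/
def triangleWave (n i : ℕ) : ℕ := min (i % (2 * n)) (2 * n - i % (2 * n))

lemma triangleWave_mod {n N : ℕ} (h : 2 * n ∣ N) (i : ℕ) :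
    triangleWave n (i % N) = triangleWave n i := by
  rw [triangleWave, triangleWave, Nat.mod_mod_of_dvd i h]

lemma mod_two_mul_succ {n : ℕ} (hn : 1 ≤ n) (i : ℕ) :
    (i + 1) % (2 * n) = if i % (2 * n) + 1 = 2 * n then 0 else i % (2 * n) + 1 := by
  have hlt : i % (2 * n) < 2 * n := Nat.mod_lt _ (by omega)
  rw [← Nat.mod_add_mod]
  split_ifs with h
  · rw [h, Nat.mod_self]
  · exact Nat.mod_eq_of_lt (by omega)

lemma dvd_iff_mod_two_mul {n : ℕ} (hn : 1 ≤ n) (i : ℕ) :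
    n ∣ i ↔ i % (2 * n) = 0 ∨ i % (2 * n) = n := by
  have hlt : i % (2 * n) < 2 * n := Nat.mod_lt _ (by omega)
  rw [← Nat.dvd_mod_iff (Dvd.intro_left 2 rfl : n ∣ 2 * n)]
  constructor
  · rintro ⟨q, hq⟩
    rw [hq] at hlt ⊢
    have : q < 2 := by nlinarith
    interval_cases q <;> simp
  · rintro (h | h) <;> simp [h]

lemma triangleWave_succ_ne {n : ℕ} (hn : 1 ≤ n) (i : ℕ) :
    triangleWave n i % 3 ≠ triangleWave n (i + 1) % 3 := by
  have hlt : i % (2 * n) < 2 * n := Nat.mod_lt _ (by omega)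
  rw [triangleWave, triangleWave, mod_two_mul_succ hn]
  split_ifs <;> omega

lemma triangleWave_of_dvd {n : ℕ} (hn : n % 3 = 1) {i : ℕ} (hi : n ∣ i) :
    triangleWave n i % 3 + triangleWave n (i + 1) % 3 = 1 := by
  have hn1 : 1 ≤ n := by omega
  have hlt : i % (2 * n) < 2 * n := Nat.mod_lt _ (by omega)
  rw [dvd_iff_mod_two_mul hn1] at hi
  rw [triangleWave, triangleWave, mod_two_mul_succ hn1]
  split_ifs <;> omega

lemma triangleWave_ne_of_not_dvd {n : ℕ} (hn : 1 ≤ n) {i : ℕ} (hi : ¬ n ∣ i + 1) :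
    triangleWave n i % 3 ≠ triangleWave n (i + 1 + 1) % 3 := by
  have hlt : i % (2 * n) < 2 * n := Nat.mod_lt _ (by omega)
  rw [dvd_iff_mod_two_mul hn, mod_two_mul_succ hn] at hi
  rw [triangleWave, triangleWave, mod_two_mul_succ hn, mod_two_mul_succ hn]
  split_ifs at hi ⊢ <;> omega

lemma jahangirGraph_adj_center {n m : ℕ} (i : Fin (n * m)) :
    (jahangirGraph n m).Adj none (some i) ↔ n ∣ (i : ℕ) := by
  simp [jahangirGraph]

lemma jahangirGraph_adj_some {n m : ℕ} (i j : Fin (n * m)) :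
    (jahangirGraph n m).Adj (some i) (some j) ↔ (cycleGraph (n * m)).Adj i j := by
  simp only [jahangirGraph, fromRel_adj, ne_eq, Option.some.injEq, reduceCtorEq, false_and,
    exists_false, false_or]
  constructor
  · rintro ⟨-, ⟨a, b, rfl, rfl, h⟩ | ⟨a, b, rfl, rfl, h⟩⟩
    exacts [h, h.symm]
  · exact fun h => ⟨h.ne, .inl ⟨i, j, rfl, rfl, h⟩⟩

/-- The centre gets colour `2`; cycle vertices get the triangle wave modulo `3`. -/
def jahangirColoring (n m : ℕ) : Option (Fin (n * m)) → Fin 3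
  | none => 2
  | some i => ⟨triangleWave n i % 3, Nat.mod_lt _ (by omega)⟩

theorem stmt10 (n m : ℕ) (hn : 1 ≤ n) (hm : 3 ≤ m) (hme : Even m)
    (hn3 : n % 3 = 1) : HasJColoring (jahangirGraph n m) 3 := by
  have hN : 3 ≤ n * m := by nlinarith
  have hdvd : 2 * n ∣ n * m := by
    rw [mul_comm 2 n]
    exact mul_dvd_mul_left n hme.two_dvd
  have center_ne (i : Fin (n * m)) (hi : n ∣ (i : ℕ)) :
      jahangirColoring n m none ≠ jahangirColoring n m (some i) := by
    have := triangleWave_of_dvd hn3 hi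
    simp only [jahangirColoring, ne_eq, Fin.ext_iff, Fin.val_two]
    omega
  refine ⟨jahangirColoring n m, ?_, ?_⟩
  · rintro (_ | i) (_ | j) h
    · exact absurd rfl h.ne
    · exact center_ne j ((jahangirGraph_adj_center j).1 h)
    · exact (center_ne i ((jahangirGraph_adj_center i).1 h.symm)).symm
    · rw [jahangirGraph_adj_some, cycleGraph_adj_iff_val_s10 (by omega)] at h
      simp only [jahangirColoring, ne_eq, Fin.ext_iff]
      rcases h with h | h <;> rw [h, triangleWave_mod hdvd]
      · exact triangleWave_succ_ne hn i
      · exact (triangleWave_succ_ne hn j).symm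
  · rintro (_ | i) k
    · have h0 : triangleWave n 0 % 3 = 0 := by simp [triangleWave]
      have hn' : triangleWave n n % 3 = 1 := by
        rw [triangleWave, Nat.mod_eq_of_lt (by omega : n < 2 * n)]
        omega
      have hlt : n < n * m := by nlinarith
      fin_cases k
      · exact ⟨some ⟨0, by omega⟩, .inr ((jahangirGraph_adj_center _).2 (dvd_zero n)),
          Fin.ext h0⟩
      · exact ⟨some ⟨n, hlt⟩, .inr ((jahangirGraph_adj_center _).2 dvd_rfl), Fin.ext hn'⟩
      · exact ⟨none, .inl rfl, rfl⟩
    · let s : Fin (n * m) := ⟨(i + 1) % (n * m), Nat.mod_lt _ (by omega)⟩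
      have hs : (jahangirGraph n m).Adj (some i) (some s) := by
        rw [jahangirGraph_adj_some, cycleGraph_adj_iff_val_s10 (by omega)]
        exact .inl rfl
      have hcs : (jahangirColoring n m (some s) : ℕ) = triangleWave n (i + 1) % 3 := by
        simp only [jahangirColoring, s, triangleWave_mod hdvd]
      have hci : (jahangirColoring n m (some i) : ℕ) = triangleWave n i % 3 := rfl
      suffices ∃ w, (jahangirGraph n m).Adj (some i) w ∧
          jahangirColoring n m w ≠ jahangirColoring n m (some i) ∧
          jahangirColoring n m w ≠ jahangirColoring n m (some s) by
        obtain ⟨w, hw, hwi, hws⟩ := this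
        have his := triangleWave_succ_ne hn i
        have : k = jahangirColoring n m (some i) ∨ k = jahangirColoring n m (some s) ∨
            k = jahangirColoring n m w := by
          simp only [ne_eq, Fin.ext_iff] at hwi hws ⊢
          omega
        rcases this with rfl | rfl | rfl
        exacts [⟨_, .inl rfl, rfl⟩, ⟨_, .inr hs, rfl⟩, ⟨_, .inr hw, rfl⟩]
      by_cases hi : n ∣ (i : ℕ)
      · have := triangleWave_of_dvd hn3 hi
        refine ⟨none, ((jahangirGraph_adj_center i).2 hi).symm, center_ne i hi, ?_⟩
        rw [ne_eq, Fin.ext_iff, hcs]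
        simp only [jahangirColoring, Fin.val_two]
        omega
      · have hi0 : (i : ℕ) ≠ 0 := fun h => hi (h ▸ dvd_zero n)
        obtain ⟨p, hp⟩ := Nat.exists_eq_succ_of_ne_zero hi0
        rw [Nat.succ_eq_add_one] at hp
        have hpi := i.isLt
        refine ⟨some ⟨p, by omega⟩, ?_, ?_, ?_⟩
        · rw [jahangirGraph_adj_some, cycleGraph_adj_iff_val_s10 (by omega)]
          exact .inr (by rw [← hp, Nat.mod_eq_of_lt hpi])
        · rw [ne_eq, Fin.ext_iff, hci, hp]
          exact triangleWave_succ_ne hn p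
        · rw [ne_eq, Fin.ext_iff, hcs, hp]
          exact triangleWave_ne_of_not_dvd hn (hp ▸ hi)
end

section
/- The complement graph of the cycle C_6 admits a J-colouring, and the maximum number of colours in a J-colouring of the complement of C_6 equals 3; that is, J(complement of C_6) = 3. -/
open SimpleGraph

theorem card_le_three_of_forall_mem {k : ℕ} (a b d : Fin k) (h : ∀ i, i = a ∨ i = b ∨ i = d) :
    k ≤ 3 := by
  have hs : (Finset.univ : Finset (Fin k)) ⊆ {a, b, d} := fun i _ => by simpa using h i
  simpa using (Finset.card_le_card hs).trans Finset.card_le_three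

instance : DecidableRel (SimpleGraph.cycleGraph 6)ᶜ.Adj := fun u v =>
  decidable_of_iff (u ≠ v ∧ ¬ (u - v = 1 ∨ v - u = 1)) (by
    rw [SimpleGraph.compl_adj, SimpleGraph.cycleGraph_adj])

theorem hasJColoring_compl_cycleGraph_six : HasJColoring (SimpleGraph.cycleGraph 6)ᶜ 3 := by
  refine ⟨![0, 0, 1, 1, 2, 2], ?_, ?_⟩ <;> decide

theorem HasJColoring.le_three_of_compl_cycleGraph_six {k : ℕ}
    (h : HasJColoring (SimpleGraph.cycleGraph 6)ᶜ k) : k ≤ 3 := by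
  obtain ⟨c, hproper, hall⟩ := h
  by_contra hk
  have hmem (v a b d : Fin 6)
      (hN : ∀ u, (u = v ∨ (SimpleGraph.cycleGraph 6)ᶜ.Adj v u) → u = v ∨ u = a ∨ u = b ∨ u = d)
      (i : Fin k) : i = c v ∨ i = c a ∨ i = c b ∨ i = c d := by
    obtain ⟨u, hu, rfl⟩ := hall v i
    rcases hN u hu with rfl | rfl | rfl | rfl <;> simp
  have h0 := hmem 0 2 3 4 (by decide)
  have h1 := hmem 1 3 4 5 (by decide)
  have h34 : c 3 ≠ c 4 := fun he =>
    hk (card_le_three_of_forall_mem (c 0) (c 2) (c 3) (by simpa [← he] using h0))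
  have h45 : c 4 ≠ c 5 := fun he =>
    hk (card_le_three_of_forall_mem (c 1) (c 3) (c 4) (by simpa [← he] using h1))
  rcases hmem 3 5 0 1 (by decide) (c 4) with he | he | he | he
  · exact h34 he.symm
  · exact h45 he
  · exact hproper (by decide) he
  · exact hproper (by decide) he

theorem stmt14 :
    AdmitsJColoring (SimpleGraph.cycleGraph 6)ᶜ ∧
      IsGreatest {k : ℕ | HasJColoring (SimpleGraph.cycleGraph 6)ᶜ k} 3 := by
  exact ⟨⟨3, by norm_num, hasJColoring_compl_cycleGraph_six⟩,
    hasJColoring_compl_cycleGraph_six, fun _ h => h.le_three_of_compl_cycleGraph_six⟩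
end

section
/- For every odd n ≥ 3 with n ≢ 0 (mod 3), the cycle graph C_n does not admit a J-colouring. -/
open SimpleGraph

open scoped Fin.NatCast Fin.CommRing in
/-- Pulled back along `ℕ → Fin (m + 2)`, a J-colouring of a cycle becomes a sequence in which
consecutive terms differ and any three consecutive terms exhaust the colours. -/
theorem IsJColoring.natCast_cycleGraph {m k : ℕ} {c : Fin (m + 2) → Fin k}
    (hc : IsJColoring (cycleGraph (m + 2)) k c) (i : ℕ) :
    c (i : Fin (m + 2)) ≠ c ((i + 1 : ℕ) : Fin (m + 2)) ∧
      ∀ j : Fin k, c (i : Fin (m + 2)) = j ∨ c ((i + 1 : ℕ) : Fin (m + 2)) = j ∨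
        c ((i + 2 : ℕ) : Fin (m + 2)) = j := by
  refine ⟨hc.1 (cycleGraph_adj.2 (Or.inr (by push_cast; ring))), fun j => ?_⟩
  obtain ⟨u, hu, rfl⟩ := hc.2 ((i + 1 : ℕ) : Fin (m + 2)) j
  rw [cycleGraph_adj] at hu
  rcases hu with rfl | hu | hu
  · exact Or.inr (Or.inl rfl)
  · left
    congr 1
    push_cast at hu
    linear_combination hu
  · right; right
    congr 1
    push_cast at hu ⊢
    linear_combination -hu

/-- A sequence with values in `{0, …, k - 1}`, with distinct consecutive terms and with all values
among any three consecutive terms, has no odd period coprime to `3`. -/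
theorem not_periodic_of_forall_lt_three_consecutive {k n : ℕ} (hodd : Odd n) (h3 : n % 3 ≠ 0)
    {g : ℕ → ℕ} (hlt : ∀ i, g i < k) (hne : ∀ i, g i ≠ g (i + 1))
    (hall : ∀ i, ∀ j < k, g i = j ∨ g (i + 1) = j ∨ g (i + 2) = j) :
    ¬ Function.Periodic g n := by
  intro hper
  have hn : g n = g 0 := by simpa using hper 0
  have hk : k ≤ 3 := by
    by_contra! hk
    have h0 := hall 0 0 (by omega)
    have h1 := hall 0 1 (by omega)
    have h2 := hall 0 2 (by omega)
    have h3 := hall 0 3 (by omega)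
    omega
  have hk' : 2 ≤ k := by
    have := hlt 0
    have := hlt 1
    have : g 0 ≠ g 1 := hne 0
    omega
  obtain rfl | rfl : k = 2 ∨ k = 3 := by omega
  · have h2 : Function.Periodic g 2 := fun i => by
      have := hlt i
      have := hlt (i + 1)
      have := hlt (i + 2)
      have := hne i
      have : g (i + 1) ≠ g (i + 2) := hne (i + 1)
      omega
    have := h2.map_mod_nat n
    rw [Nat.odd_iff.1 hodd] at this
    exact hne 0 (by simp [this, hn])
  · have hdist (i : ℕ) : g i ≠ g (i + 2) := by
      have := hall i 0 (by omega)
      have := hall i 1 (by omega)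
      have := hall i 2 (by omega)
      omega
    have hp3 : Function.Periodic g 3 := fun i => by
      have := hlt i
      have := hlt (i + 1)
      have := hlt (i + 2)
      have := hlt (i + 3)
      have := hne i
      have : g (i + 1) ≠ g (i + 2) := hne (i + 1)
      have : g (i + 2) ≠ g (i + 3) := hne (i + 2)
      have := hdist i
      have : g (i + 1) ≠ g (i + 3) := hdist (i + 1)
      omega
    have := hp3.map_mod_nat n
    obtain h | h : n % 3 = 1 ∨ n % 3 = 2 := by omega
    · rw [h] at this
      exact hne 0 (by simp [this, hn])
    · rw [h] at this
      exact hdist 0 (by simp [this, hn])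

theorem stmt18 (n : ℕ) (hn : 3 ≤ n) (hodd : Odd n) (h3 : n % 3 ≠ 0) :
    ¬ AdmitsJColoring (SimpleGraph.cycleGraph n) := by
  rintro ⟨k, -, c, hc⟩
  obtain ⟨m, rfl⟩ : ∃ m, n = m + 2 := ⟨n - 2, by omega⟩
  open scoped Fin.NatCast Fin.CommRing in
  refine not_periodic_of_forall_lt_three_consecutive (k := k) hodd h3
    (g := fun i => (c (i : Fin (m + 2)) : ℕ)) (fun i => (c _).isLt)
    (fun i => Fin.val_ne_of_ne (hc.natCast_cycleGraph i).1)
    (fun i j hj => ?_) (fun i => ?_)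
  · simpa only [Fin.ext_iff] using (hc.natCast_cycleGraph i).2 ⟨j, hj⟩
  · open scoped Fin.NatCast Fin.CommRing in
    have : ((i + (m + 2) : ℕ) : Fin (m + 2)) = i := by
      rw [Nat.cast_add, Fin.natCast_self, add_zero]
    simp only [this]
end
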